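/- For every ξ in the open cube (−π,π)^d ⊂ ℝ^d, one has lim_{k→∞} |ξ|^{2k} Σ_{j ∈ ℤ^d, j ≠ 0} |ξ − 2πj|^{−2k} = 0; equivalently, lim_{k→∞} Λ^k_0(ξ) = (2π)^{−d/2}. -/

import Mathlib

open Filter Complex MeasureTheory

noncomputable section

/-- The lattice point `2π j ∈ ℝ^d` associated with `j ∈ ℤ^d`. -/
def latticePt (d : ℕ) (j : Fin d → ℤ) : EuclideanSpace ℝ (Fin d) :=
  (WithLp.equiv 2 (Fin d → ℝ)).symm fun i => 2 * Real.pi * (j i)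

/-- The lattice sum `Σ_{j ∈ ℤ^d, j ≠ 0} |ξ − 2πj|^{−2k}`. -/
def latticeSum (d k : ℕ) (ξ : EuclideanSpace ℝ (Fin d)) : ℝ :=
  ∑' j : {j : Fin d → ℤ // j ≠ 0}, (‖ξ - latticePt d j.1‖ ^ (2 * k))⁻¹

/-- The function `Λ^k_0(ξ) = (2π)^{−d/2} (1 + |ξ|^{2k} Σ_{j ≠ 0} |ξ − 2πj|^{−2k})⁻¹`. -/
def Lam0 (d k : ℕ) (ξ : EuclideanSpace ℝ (Fin d)) : ℝ :=
  (2 * Real.pi) ^ (-(d : ℝ) / 2) * (1 + ‖ξ‖ ^ (2 * k) * latticeSum d k ξ)⁻¹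

end

lemma latticePt_apply (d : ℕ) (j : Fin d → ℤ) (i : Fin d) :
    latticePt d j i = 2 * Real.pi * (j i) := rfl

lemma latticePt_injective (d : ℕ) : Function.Injective (latticePt d) := by
  intro j j' h
  ext i
  have hi : latticePt d j i = latticePt d j' i := by rw [h]
  simpa [latticePt_apply, Real.pi_ne_zero] using hi

/-- The inverse powers of the distances from `ξ` to the points `2πj` are summable for some
exponent. -/
lemma exists_summable_norm_sub_latticePt_inv_pow (d : ℕ) (ξ : EuclideanSpace ℝ (Fin d)) :
    ∃ n : ℕ, Summable fun j : Fin d → ℤ => ‖ξ - latticePt d j‖⁻¹ ^ n := by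
  have hu : ∀ _ : Fin d, IsUnit (2 * Real.pi) := fun _ =>
    (by positivity : (2 * Real.pi) ≠ 0).isUnit
  let b := (EuclideanSpace.basisFun (Fin d) ℝ).toBasis.isUnitSMul hu
  let L := Submodule.span ℤ (Set.range b)
  have hmem : ∀ j, latticePt d j ∈ L := by
    intro j
    have hj : latticePt d j = ∑ i, j i • b i := by
      ext i
      simp [latticePt_apply, b, Module.Basis.isUnitSMul_apply, mul_comm,
        Pi.single_apply]
    rw [hj]
    exact Submodule.sum_mem _ fun i _ =>
      L.smul_mem _ (Submodule.subset_span (Set.mem_range_self i))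
  refine ⟨Module.finrank ℤ L + 1, ?_⟩
  have hs := ZLattice.summable_norm_sub_inv_pow L _ (Nat.lt_succ_self _) ξ
  have hinj : Function.Injective fun j => (⟨latticePt d j, hmem j⟩ : L) := fun j j' h =>
    latticePt_injective d (congrArg Subtype.val h)
  refine (hs.comp_injective hinj).congr fun j => ?_
  simp [norm_sub_rev]

/-- A point of the open cube `(-π, π)^d` is strictly closer to the origin than to any other
point of `2πℤ^d`. -/
lemma norm_lt_norm_sub_latticePt {d : ℕ} {ξ : EuclideanSpace ℝ (Fin d)}
    (hξ : ∀ i, |ξ i| < Real.pi) {j : Fin d → ℤ} (hj : j ≠ 0) :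
    ‖ξ‖ < ‖ξ - latticePt d j‖ := by
  have hlt : ∀ i, j i ≠ 0 → |ξ i| < |ξ i - 2 * Real.pi * j i| := by
    intro i hi
    have h1 : (1 : ℝ) ≤ |(j i : ℝ)| := by exact_mod_cast Int.one_le_abs hi
    have h2 : |2 * Real.pi * (j i : ℝ)| = 2 * Real.pi * |(j i : ℝ)| := by
      rw [abs_mul, abs_of_pos Real.two_pi_pos]
    have h3 := abs_sub_abs_le_abs_sub (2 * Real.pi * (j i : ℝ)) (ξ i)
    rw [abs_sub_comm] at h3
    nlinarith [hξ i, Real.pi_pos]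
  obtain ⟨i₀, hi₀⟩ := Function.ne_iff.mp hj
  rw [EuclideanSpace.norm_eq, EuclideanSpace.norm_eq]
  refine Real.sqrt_lt_sqrt (by positivity) (Finset.sum_lt_sum (fun i _ => ?_)
    ⟨i₀, Finset.mem_univ _, ?_⟩)
  · by_cases hi : j i = 0
    · simp [latticePt_apply, hi]
    · simpa [latticePt_apply] using sq_le_sq.mpr (hlt i hi).le
  · simpa [latticePt_apply] using sq_lt_sq.mpr (hlt i₀ hi₀)

lemma tendsto_norm_pow_mul_latticeSum {d : ℕ} {ξ : EuclideanSpace ℝ (Fin d)}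
    (hξ : ∀ i, |ξ i| < Real.pi) :
    Tendsto (fun k : ℕ => ‖ξ‖ ^ (2 * k) * latticeSum d k ξ) atTop (nhds 0) := by
  obtain ⟨n, hn⟩ := exists_summable_norm_sub_latticePt_inv_pow d ξ
  let r : {j : Fin d → ℤ // j ≠ 0} → ℝ := fun j => ‖ξ‖ / ‖ξ - latticePt d j.1‖
  have hr0 : ∀ j, 0 ≤ r j := fun j => by positivity
  have hr1 : ∀ j, r j < 1 := fun j =>
    have h := norm_lt_norm_sub_latticePt hξ j.2
    (div_lt_one ((norm_nonneg _).trans_lt h)).mpr h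
  have hsum : Summable fun j => r j ^ n := by
    refine ((hn.subtype {j | j ≠ 0}).mul_left (‖ξ‖ ^ n)).congr fun j => ?_
    simp [r, div_eq_mul_inv, mul_pow]
  have hlim : Tendsto (fun k : ℕ => ∑' j, r j ^ (2 * k)) atTop (nhds (∑' _ : {j : Fin d → ℤ // j ≠ 0}, 0)) := by
    refine tendsto_tsum_of_dominated_convergence hsum (fun j => ?_) ?_
    · exact (tendsto_pow_atTop_nhds_zero_of_lt_one (hr0 j) (hr1 j)).comp
        (tendsto_id.const_mul_atTop' two_pos)
    · filter_upwards [eventually_ge_atTop n] with k hk j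
      rw [Real.norm_of_nonneg (pow_nonneg (hr0 j) _)]
      exact pow_le_pow_of_le_one (hr0 j) (hr1 j).le (by lia)
  rw [tsum_zero] at hlim
  refine hlim.congr fun k => ?_
  rw [latticeSum, ← tsum_mul_left]
  simp only [r, div_eq_mul_inv, mul_pow, inv_pow]

/-- For `ξ` in the open cube `(−π,π)^d`, `|ξ|^{2k} Σ_{j ≠ 0} |ξ − 2πj|^{−2k} → 0` as
`k → ∞`; equivalently `Λ^k_0(ξ) → (2π)^{−d/2}`. -/
theorem tendsto_Lam0_of_mem_openCube (d : ℕ) (hd : 0 < d) (ξ : EuclideanSpace ℝ (Fin d))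
    (hξ : ∀ i, |ξ i| < Real.pi) :
    Tendsto (fun k : ℕ => ‖ξ‖ ^ (2 * k) * latticeSum d k ξ) atTop (nhds 0) ∧
    Tendsto (fun k : ℕ => Lam0 d k ξ) atTop
      (nhds ((2 * Real.pi) ^ (-(d : ℝ) / 2))) := by
  have h := tendsto_norm_pow_mul_latticeSum hξ
  refine ⟨h, ?_⟩
  simpa [Lam0] using ((h.const_add 1).inv₀ (by simp)).const_mul
    ((2 * Real.pi) ^ (-(d : ℝ) / 2))
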